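/- arXiv:0911.0784 — 5 statements merged into one kernel-verified Lean document; each statement's English description precedes it below -/
import Mathlib

section
/- There exists a constant C > 0, depending only on λ₁, λ₂ and η̃ (and independent of R), such that for every R > 2 the function Φ_R is continuously differentiable on ℂⁿ and its first real Fréchet derivative satisfies ‖DΦ_R(z)‖ ≤ C·R⁻² for every z ∈ ℂⁿ. (Estimate (30021) in the paper's proof of Lemma 3.3.) -/
/-- The function `Φ_R(z) = Σ_{i=1}^{2} (λᵢ/2)|zᵢ|²·η̃(R²|zᵢ|)` on `ℂⁿ`
(the terms with index `≥ 2` in the 0-indexed sum carry coefficient `0`). -/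
noncomputable def PhiR (n : ℕ) (l1 l2 : ℝ) (eta : ℝ → ℝ) (R : ℝ)
    (z : Fin n → ℂ) : ℝ :=
  ∑ i : Fin n,
    (if (i : ℕ) = 0 then l1 / 2 else if (i : ℕ) = 1 then l2 / 2 else 0)
      * ‖z i‖ ^ 2 * eta (R ^ 2 * ‖z i‖)

/-- The cutoff `η_R(z) = Π_{i=1}^{n} η̃(R|zᵢ|)` on `ℂⁿ`. -/
noncomputable def etaRfun (n : ℕ) (eta : ℝ → ℝ) (R : ℝ)
    (z : Fin n → ℂ) : ℝ :=
  ∏ i : Fin n, eta (R * ‖z i‖)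

/-- The function `ψ_R = Φ_R · η_R` on `ℂⁿ`. -/
noncomputable def psiR (n : ℕ) (l1 l2 : ℝ) (eta : ℝ → ℝ) (R : ℝ)
    (z : Fin n → ℂ) : ℝ :=
  PhiR n l1 l2 eta R z * etaRfun n eta R z

theorem contDiff_norm_sq_mul_comp_norm {E : Type*} [NormedAddCommGroup E] [InnerProductSpace ℝ E]
    {eta : ℝ → ℝ} {k : WithTop ℕ∞} {δ : ℝ} (hδ : 0 < δ) (heta : ContDiff ℝ k eta)
    (heta1 : ∀ r : ℝ, r ≤ δ → eta r = 1) :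
    ContDiff ℝ k (fun w : E => ‖w‖ ^ 2 * eta ‖w‖) := by
  rw [contDiff_iff_contDiffAt]
  intro w
  rcases eq_or_ne w 0 with rfl | hw
  · refine ((contDiff_norm_sq ℝ).contDiffAt (x := (0 : E))).congr_of_eventuallyEq ?_
    filter_upwards [Metric.ball_mem_nhds (0 : E) hδ] with v hv
    rw [heta1 _ (mem_ball_zero_iff.mp hv).le, mul_one]
  · exact (contDiff_norm_sq ℝ).contDiffAt.mul
      (heta.contDiffAt.comp w (contDiffAt_norm ℝ hw))

theorem hasCompactSupport_norm_sq_mul_comp_norm {E : Type*} [NormedAddCommGroup E] [ProperSpace E]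
    {eta : ℝ → ℝ} {ρ : ℝ} (heta0 : ∀ r : ℝ, ρ ≤ r → eta r = 0) :
    HasCompactSupport (fun w : E => ‖w‖ ^ 2 * eta ‖w‖) := by
  refine HasCompactSupport.intro (isCompact_closedBall (0 : E) ρ) fun w hw => ?_
  rw [heta0 _ (by simpa using (not_le.mp (mt mem_closedBall_zero_iff.mpr hw)).le), mul_zero]

theorem PhiR_eq_sum_rescaled (n : ℕ) (l1 l2 : ℝ) (eta : ℝ → ℝ) {R : ℝ} (hR : R ≠ 0) :
    PhiR n l1 l2 eta R = fun z => ∑ i : Fin n,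
      ((if (i : ℕ) = 0 then l1 / 2 else if (i : ℕ) = 1 then l2 / 2 else 0) * R⁻¹ ^ 4) *
        (‖R ^ 2 • z i‖ ^ 2 * eta ‖R ^ 2 • z i‖) := by
  funext z
  refine Finset.sum_congr rfl fun i _ => ?_
  rw [norm_smul, Real.norm_of_nonneg (sq_nonneg R)]
  field_simp

theorem norm_fderiv_sum_rescaled_le {ι E : Type*} [Fintype ι] [NormedAddCommGroup E]
    [NormedSpace ℝ E] {G : E → ℝ} (hG : Differentiable ℝ G) {M : ℝ}
    (hM : ∀ w, ‖fderiv ℝ G w‖ ≤ M) (c : ι → ℝ) (t : ℝ) (z : ι → E) :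
    ‖fderiv ℝ (fun z : ι → E => ∑ i, c i * G (t • z i)) z‖ ≤ ∑ i, |c i| * (|t| * M) := by
  have hderiv : HasFDerivAt (fun z : ι → E => ∑ i, c i * G (t • z i))
      (∑ i, c i • (fderiv ℝ G (t • z i)).comp
        (t • ContinuousLinearMap.proj (R := ℝ) (φ := fun _ : ι => E) i)) z :=
    HasFDerivAt.fun_sum fun i _ =>
      ((hG (t • z i)).hasFDerivAt.comp z ((hasFDerivAt_apply i z).const_smul t)).const_mul (c i)
  have hproj (i : ι) : ‖ContinuousLinearMap.proj (R := ℝ) (φ := fun _ : ι => E) i‖ ≤ 1 :=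
    ContinuousLinearMap.opNorm_le_bound _ zero_le_one fun x => by
      simpa using norm_le_pi_norm x i
  rw [hderiv.fderiv]
  refine (norm_sum_le _ _).trans (Finset.sum_le_sum fun i _ => ?_)
  rw [norm_smul, Real.norm_eq_abs]
  refine mul_le_mul_of_nonneg_left ((ContinuousLinearMap.opNorm_comp_le _ _).trans ?_)
    (abs_nonneg _)
  rw [norm_smul, Real.norm_eq_abs, mul_comm |t| M]
  exact mul_le_mul (hM _) (mul_le_of_le_one_right (abs_nonneg t) (hproj i)) (by positivity)
    ((norm_nonneg _).trans (hM 0))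

/-- There exists `C > 0` (independent of `R`) such that for every
`R > 2`, `Φ_R` is continuously differentiable and `‖DΦ_R(z)‖ ≤ C·R⁻²` for all `z`. -/
theorem stmt10 (n : ℕ) (hn : 2 ≤ n) (eta : ℝ → ℝ) (heta : ContDiff ℝ 2 eta)
    (heta1 : ∀ r : ℝ, r ≤ 1 / 2 → eta r = 1) (heta0 : ∀ r : ℝ, 1 ≤ r → eta r = 0)
    (l1 l2 : ℝ) (hl1 : 0 < l1) (hl2 : 0 < l2) :
    ∃ C : ℝ, 0 < C ∧ ∀ R : ℝ, 2 < R →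
      ContDiff ℝ 1 (PhiR n l1 l2 eta R) ∧
      ∀ z : Fin n → ℂ, ‖fderiv ℝ (PhiR n l1 l2 eta R) z‖ ≤ C * R⁻¹ ^ 2 := by
  have hG : ContDiff ℝ 1 (fun w : ℂ => ‖w‖ ^ 2 * eta ‖w‖) :=
    contDiff_norm_sq_mul_comp_norm one_half_pos (heta.of_le one_le_two) heta1
  obtain ⟨M, hM⟩ := (hG.continuous_fderiv one_ne_zero).bounded_above_of_compact_support
    ((hasCompactSupport_norm_sq_mul_comp_norm heta0).fderiv ℝ)
  have hM0 : 0 ≤ M := (norm_nonneg _).trans (hM 0)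
  set c : Fin n → ℝ := fun i =>
    if (i : ℕ) = 0 then l1 / 2 else if (i : ℕ) = 1 then l2 / 2 else 0
  refine ⟨(∑ i, |c i|) * M + 1, by positivity, fun R hR => ?_⟩
  have hR0 : 0 < R := by linarith
  rw [PhiR_eq_sum_rescaled n l1 l2 eta hR0.ne']
  refine ⟨ContDiff.sum fun i _ => contDiff_const.mul
    (hG.comp ((contDiff_apply ℝ ℂ i).const_smul (R ^ 2))), fun z => ?_⟩
  refine (norm_fderiv_sum_rescaled_le (hG.differentiable one_ne_zero) hM
    (fun i => c i * R⁻¹ ^ 4) (R ^ 2) z).trans ?_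
  have hscale : ∑ i, |c i * R⁻¹ ^ 4| * (|R ^ 2| * M) = (∑ i, |c i|) * M * R⁻¹ ^ 2 := by
    rw [Finset.sum_mul, Finset.sum_mul]
    refine Finset.sum_congr rfl fun i _ => ?_
    rw [abs_mul, abs_of_pos (by positivity : 0 < R⁻¹ ^ 4), abs_of_pos (by positivity : 0 < R ^ 2)]
    field_simp
  rw [hscale]
  gcongr
  linarith
end

section
/- There exists a constant C > 0, depending only on λ₁, λ₂ and η̃ (and independent of R), such that for every R > 2 the function Φ_R is twice continuously differentiable on ℂⁿ and its second real Fréchet derivative satisfies ‖D²Φ_R(z)‖ ≤ C for every z ∈ ℂⁿ. (Estimate (30031) in the paper's proof of Lemma 3.3; note that on the support of η̃'(R²|z_i|) and η̃''(R²|z_i|) one has 1/2 ≤ R²|z_i| ≤ 1, which makes the R-dependent factors cancel.) -/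
/-- The squared norm times a radial cutoff that is constant near `0` is as smooth as the cutoff. -/
theorem contDiff_norm_sq_mul_radial {E : Type*} [NormedAddCommGroup E] [InnerProductSpace ℝ E]
    {k : WithTop ℕ∞} {eta : ℝ → ℝ} (heta : ContDiff ℝ k eta)
    (heta1 : ∀ r : ℝ, r ≤ 1 / 2 → eta r = 1) :
    ContDiff ℝ k (fun w : E => ‖w‖ ^ 2 * eta ‖w‖) := by
  rw [contDiff_iff_contDiffAt]
  intro w
  by_cases hw : w = 0
  · subst hw
    have hsq : ContDiffAt ℝ k (fun w : E => ‖w‖ ^ 2) 0 := (contDiff_norm_sq ℝ).contDiffAt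
    refine hsq.congr_of_eventuallyEq ?_
    filter_upwards [Metric.ball_mem_nhds (0 : E) (by norm_num : (0 : ℝ) < 1 / 2)] with v hv
    rw [heta1 _ (mem_ball_zero_iff.mp hv).le, mul_one]
  · exact (contDiff_norm_sq ℝ).contDiffAt.mul
      (heta.contDiffAt.comp w (contDiffAt_norm ℝ hw))

/-- The second derivative of a radial cutoff of the squared norm is bounded. -/
theorem exists_bound_iteratedFDeriv_norm_sq_mul_radial {E : Type*} [NormedAddCommGroup E]
    [InnerProductSpace ℝ E] [ProperSpace E] {eta : ℝ → ℝ} (heta : ContDiff ℝ 2 eta)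
    (heta1 : ∀ r : ℝ, r ≤ 1 / 2 → eta r = 1) (heta0 : ∀ r : ℝ, 1 ≤ r → eta r = 0) :
    ∃ K : ℝ, ∀ w : E, ‖iteratedFDeriv ℝ 2 (fun w : E => ‖w‖ ^ 2 * eta ‖w‖) w‖ ≤ K := by
  have hsupp : HasCompactSupport (fun w : E => ‖w‖ ^ 2 * eta ‖w‖) := by
    refine HasCompactSupport.intro (isCompact_closedBall (0 : E) 1) fun w hw => ?_
    rw [mem_closedBall_zero_iff, not_le] at hw
    rw [heta0 _ hw.le, mul_zero]
  exact (hsupp.iteratedFDeriv 2).exists_bound_of_continuous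
    ((contDiff_norm_sq_mul_radial heta heta1).continuous_iteratedFDeriv (m := 2) le_rfl)

/-- Composing with a linear map of norm at most `a` and multiplying by `a⁻²` does not increase a
bound on the second derivative. -/
theorem norm_iteratedFDeriv_two_rescale_le {E F : Type*} [NormedAddCommGroup E] [NormedSpace ℝ E]
    [NormedAddCommGroup F] [NormedSpace ℝ F] {g : F → ℝ} (hg : ContDiff ℝ 2 g) {K : ℝ}
    (hK : ∀ w, ‖iteratedFDeriv ℝ 2 g w‖ ≤ K) {a : ℝ} (ha : 0 < a) (L : E →L[ℝ] F)
    (hL : ‖L‖ ≤ a) (c : ℝ) (z : E) :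
    ‖iteratedFDeriv ℝ 2 (fun z => (c * (a ^ 2)⁻¹) • (g ∘ L) z) z‖ ≤ |c| * K := by
  have hK0 : 0 ≤ K := (norm_nonneg _).trans (hK (L z))
  rw [iteratedFDeriv_const_smul_apply' (hg.comp L.contDiff).contDiffAt, norm_smul,
    L.iteratedFDeriv_comp_right hg z le_rfl]
  have hcomp : ‖(iteratedFDeriv ℝ 2 g (L z)).compContinuousLinearMap fun _ => L‖ ≤ K * a ^ 2 := by
    refine (ContinuousMultilinearMap.norm_compContinuousLinearMap_le _ _).trans ?_
    rw [Fin.prod_const]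
    gcongr
    exact hK _
  calc ‖c * (a ^ 2)⁻¹‖ * _ ≤ ‖c * (a ^ 2)⁻¹‖ * (K * a ^ 2) := by gcongr
    _ = |c| * K := by
      rw [Real.norm_eq_abs, abs_mul, abs_of_pos (a := (a ^ 2)⁻¹) (by positivity)]
      field_simp

/-- There exists `C > 0` (independent of `R`) such that for every
`R > 2`, `Φ_R` is twice continuously differentiable and `‖D²Φ_R(z)‖ ≤ C` for all `z`. -/
theorem stmt11 (n : ℕ) (hn : 2 ≤ n) (eta : ℝ → ℝ) (heta : ContDiff ℝ 2 eta)
    (heta1 : ∀ r : ℝ, r ≤ 1 / 2 → eta r = 1) (heta0 : ∀ r : ℝ, 1 ≤ r → eta r = 0)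
    (l1 l2 : ℝ) (hl1 : 0 < l1) (hl2 : 0 < l2) :
    ∃ C : ℝ, 0 < C ∧ ∀ R : ℝ, 2 < R →
      ContDiff ℝ 2 (PhiR n l1 l2 eta R) ∧
      ∀ z : Fin n → ℂ, ‖iteratedFDeriv ℝ 2 (PhiR n l1 l2 eta R) z‖ ≤ C := by
  have hg := contDiff_norm_sq_mul_radial (E := ℂ) heta heta1
  obtain ⟨K, hK⟩ := exists_bound_iteratedFDeriv_norm_sq_mul_radial (E := ℂ) heta heta1 heta0
  have hK0 : 0 ≤ K := (norm_nonneg _).trans (hK 0)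
  set g : ℂ → ℝ := fun w => ‖w‖ ^ 2 * eta ‖w‖ with hgdef
  set c : Fin n → ℝ := fun i =>
    if (i : ℕ) = 0 then l1 / 2 else if (i : ℕ) = 1 then l2 / 2 else 0 with hc
  refine ⟨∑ i, |c i| * K + 1, by positivity, fun R hR => ?_⟩
  have ha : 0 < R ^ 2 := by positivity
  let L : Fin n → (Fin n → ℂ) →L[ℝ] ℂ := fun i => R ^ 2 • ContinuousLinearMap.proj i
  have hL : ∀ i, ‖L i‖ ≤ R ^ 2 := fun i => by
    refine ContinuousLinearMap.opNorm_le_bound _ ha.le fun z => ?_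
    simp only [L, smul_apply, ContinuousLinearMap.proj_apply, norm_smul,
      Real.norm_of_nonneg ha.le]
    gcongr
    exact norm_le_pi_norm z i
  have hPhi : PhiR n l1 l2 eta R =
      fun z => ∑ i, (c i * ((R ^ 2) ^ 2)⁻¹) • (g ∘ L i) z := by
    funext z
    refine Finset.sum_congr rfl fun i _ => ?_
    simp only [hgdef, hc, L, Function.comp_apply, smul_apply,
      ContinuousLinearMap.proj_apply, norm_smul, Real.norm_of_nonneg ha.le, smul_eq_mul]
    field_simp
  have hterm : ∀ i, ContDiff ℝ 2 fun z => (c i * ((R ^ 2) ^ 2)⁻¹) • (g ∘ L i) z := fun i =>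
    (hg.comp (L i).contDiff).const_smul _
  rw [hPhi]
  refine ⟨ContDiff.sum fun i _ => hterm i, fun z => ?_⟩
  rw [iteratedFDeriv_fun_sum_apply fun i _ => (hterm i).contDiffAt]
  refine (norm_sum_le _ _).trans ((Finset.sum_le_sum fun i _ => ?_).trans
    (le_add_of_nonneg_right zero_le_one))
  exact norm_iteratedFDeriv_two_rescale_le hg hK ha (L i) (hL i) (c i) z
end

section
/- There exists a constant C > 0, depending only on n, λ₁, λ₂ and η̃ (and independent of R), such that for every R > 2 and every z ∈ ℂⁿ, the first real Fréchet derivative of ψ_R satisfies ‖Dψ_R(z)‖ ≤ C·R⁻². (Part (1) of the paper's Lemma 3.3: |(ψ_R)_α| ≤ C/R² for 1 ≤ α ≤ n; it follows from the product rule together with the bounds |Φ_R| ≤ C R⁻⁴, ‖DΦ_R‖ ≤ C R⁻², |η_R| ≤ C and ‖Dη_R‖ ≤ C R.) -/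
/-- A `C¹` function vanishing on `[1, ∞)` is bounded and Lipschitz on `[0, ∞)`. -/
lemma exists_bound_and_lipschitz_of_contDiff_of_eq_zero {f : ℝ → ℝ} (hf : ContDiff ℝ 1 f)
    (h0 : ∀ r, 1 ≤ r → f r = 0) :
    ∃ K : ℝ, 0 ≤ K ∧ (∀ s, 0 ≤ s → |f s| ≤ K) ∧
      ∀ s t, 0 ≤ s → 0 ≤ t → |f s - f t| ≤ K * |s - t| := by
  obtain ⟨K, hK⟩ := hf.contDiffOn.exists_lipschitzOnWith (s := Set.Icc 0 1) one_ne_zero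
    (convex_Icc 0 1) isCompact_Icc
  have hmin (s : ℝ) : f s = f (min s 1) := by
    rcases le_total s 1 with h | h
    · rw [min_eq_left h]
    · rw [min_eq_right h, h0 s h, h0 1 le_rfl]
  have hlip (s t : ℝ) (hs : 0 ≤ s) (ht : 0 ≤ t) : |f s - f t| ≤ K * |min s 1 - min t 1| := by
    rw [hmin s, hmin t, ← Real.dist_eq, ← Real.dist_eq]
    exact hK.dist_le_mul _ ⟨le_min hs zero_le_one, min_le_right _ _⟩ _
      ⟨le_min ht zero_le_one, min_le_right _ _⟩
  refine ⟨K, K.2, fun s hs => ?_, fun s t hs ht => (hlip s t hs ht).trans ?_⟩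
  · have h := hlip s 1 hs zero_le_one
    rw [h0 1 le_rfl, sub_zero, min_self] at h
    refine h.trans (mul_le_of_le_one_right K.2 ?_)
    have h1 := le_min hs zero_le_one
    have h2 := min_le_right s 1
    rw [abs_le]
    constructor <;> linarith
  · refine mul_le_mul_of_nonneg_left ?_ K.2
    refine (abs_min_sub_min_le_max s 1 t 1).trans_eq ?_
    rw [sub_self, abs_zero, max_eq_left (abs_nonneg (s - t))]

/-- A product of factors bounded by `K` in absolute value. -/
lemma Finset.abs_prod_le_pow_card {ι : Type*} (s : Finset ι) {a : ι → ℝ} {K : ℝ}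
    (ha : ∀ i, |a i| ≤ K) : |∏ i ∈ s, a i| ≤ K ^ s.card := by
  rw [Finset.abs_prod, ← Finset.prod_const]
  exact Finset.prod_le_prod (fun i _ => abs_nonneg _) fun i _ => ha i

/-- Telescoping bound for the difference of two products. -/
lemma Finset.abs_prod_sub_prod_le_card_mul {ι : Type*} (s : Finset ι) {a b : ι → ℝ} {K d : ℝ}
    (hK : 0 ≤ K) (ha : ∀ i, |a i| ≤ K) (hb : ∀ i, |b i| ≤ K) (hab : ∀ i, |a i - b i| ≤ K * d) :
    |∏ i ∈ s, a i - ∏ i ∈ s, b i| ≤ s.card * K ^ s.card * d := by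
  classical
  induction s using Finset.induction_on with
  | empty => simp
  | insert j s hj ih =>
    rw [Finset.prod_insert hj, Finset.prod_insert hj, Finset.card_insert_of_notMem hj]
    have hprod : |∏ i ∈ s, b i| ≤ K ^ s.card := s.abs_prod_le_pow_card hb
    calc |a j * ∏ i ∈ s, a i - b j * ∏ i ∈ s, b i|
        = |a j * (∏ i ∈ s, a i - ∏ i ∈ s, b i) + (a j - b j) * ∏ i ∈ s, b i| := by ring_nf
      _ ≤ |a j| * |∏ i ∈ s, a i - ∏ i ∈ s, b i| + |a j - b j| * |∏ i ∈ s, b i| := by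
        rw [← abs_mul, ← abs_mul]
        exact abs_add_le _ _
      _ ≤ K * (s.card * K ^ s.card * d) + K * d * K ^ s.card := by
        have hd : 0 ≤ K * d := (abs_nonneg _).trans (hab j)
        gcongr
        exacts [ha j, hab j]
      _ = _ := by push_cast; ring

/-- `Φ_R` is `O(R⁻⁴)` and `O(R⁻²)`-Lipschitz, uniformly in `R`. -/
lemma exists_bound_and_lipschitz_PhiR (n : ℕ) (l1 l2 : ℝ) {eta : ℝ → ℝ} (heta : ContDiff ℝ 1 eta)
    (heta0 : ∀ r, 1 ≤ r → eta r = 0) :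
    ∃ A : ℝ, 0 ≤ A ∧ ∀ R : ℝ, 0 < R →
      (∀ z, |PhiR n l1 l2 eta R z| ≤ A * R⁻¹ ^ 4) ∧
      ∀ z w, |PhiR n l1 l2 eta R z - PhiR n l1 l2 eta R w| ≤ A * R⁻¹ ^ 2 * ‖z - w‖ := by
  obtain ⟨K, hK0, hKb, hKl⟩ := exists_bound_and_lipschitz_of_contDiff_of_eq_zero
    (f := fun s => s ^ 2 * eta s) (by fun_prop) fun r hr => by simp [heta0 r hr]
  set c : Fin n → ℝ := fun i => if (i : ℕ) = 0 then l1 / 2 else if (i : ℕ) = 1 then l2 / 2 else 0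
    with hc
  have hPhi {R : ℝ} (hR : 0 < R) (z : Fin n → ℂ) : PhiR n l1 l2 eta R z =
      ∑ i, c i * (R⁻¹ ^ 4 * ((R ^ 2 * ‖z i‖) ^ 2 * eta (R ^ 2 * ‖z i‖))) := by
    refine Finset.sum_congr rfl fun i _ => ?_
    change c i * _ * _ = _
    field_simp
  refine ⟨(∑ i, |c i|) * K, by positivity, fun R hR => ⟨fun z => ?_, fun z w => ?_⟩⟩
  · rw [hPhi hR, Finset.sum_mul, Finset.sum_mul]
    refine (Finset.abs_sum_le_sum_abs _ _).trans (Finset.sum_le_sum fun i _ => ?_)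
    rw [abs_mul, abs_mul, abs_of_nonneg (by positivity : 0 ≤ R⁻¹ ^ 4), mul_assoc, mul_comm K]
    gcongr
    exact hKb _ (by positivity)
  · rw [hPhi hR, hPhi hR, ← Finset.sum_sub_distrib, Finset.sum_mul, Finset.sum_mul, Finset.sum_mul]
    refine (Finset.abs_sum_le_sum_abs _ _).trans (Finset.sum_le_sum fun i _ => ?_)
    rw [← mul_sub, ← mul_sub, abs_mul, abs_mul, abs_of_nonneg (by positivity : 0 ≤ R⁻¹ ^ 4)]
    calc _ ≤ |c i| * (R⁻¹ ^ 4 * (K * |R ^ 2 * ‖z i‖ - R ^ 2 * ‖w i‖|)) := by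
          gcongr
          exact hKl _ _ (by positivity) (by positivity)
      _ = |c i| * K * R⁻¹ ^ 2 * |‖z i‖ - ‖w i‖| := by
          rw [← mul_sub, abs_mul, abs_of_pos (by positivity : 0 < R ^ 2)]
          field_simp
      _ ≤ |c i| * K * R⁻¹ ^ 2 * ‖z - w‖ := by
          gcongr
          exact (abs_norm_sub_norm_le _ _).trans (norm_le_pi_norm (z - w) i)

/-- `η_R` is bounded and `O(R)`-Lipschitz, uniformly in `R`. -/
lemma exists_bound_and_lipschitz_etaRfun (n : ℕ) {eta : ℝ → ℝ} (heta : ContDiff ℝ 1 eta)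
    (heta0 : ∀ r, 1 ≤ r → eta r = 0) :
    ∃ B : ℝ, 0 ≤ B ∧ ∀ R : ℝ, 0 < R →
      (∀ z, |etaRfun n eta R z| ≤ B) ∧
      ∀ z w, |etaRfun n eta R z - etaRfun n eta R w| ≤ B * R * ‖z - w‖ := by
  obtain ⟨K, hK0, hKb, hKl⟩ := exists_bound_and_lipschitz_of_contDiff_of_eq_zero heta heta0
  refine ⟨(n + 1) * K ^ n, by positivity, fun R hR => ⟨fun z => ?_, fun z w => ?_⟩⟩
  · have h : |etaRfun n eta R z| ≤ K ^ n := by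
      simpa [etaRfun] using Finset.univ.abs_prod_le_pow_card (a := fun i => eta (R * ‖z i‖))
        fun i => hKb _ (by positivity)
    refine h.trans (le_mul_of_one_le_left (by positivity) ?_)
    simp
  · have h := Finset.univ.abs_prod_sub_prod_le_card_mul hK0
      (a := fun i => eta (R * ‖z i‖)) (b := fun i => eta (R * ‖w i‖)) (d := R * ‖z - w‖)
      (fun i => hKb _ (by positivity)) (fun i => hKb _ (by positivity)) fun i => by
        refine (hKl _ _ (by positivity) (by positivity)).trans ?_
        rw [← mul_sub, abs_mul, abs_of_pos hR]
        gcongr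
        exact (abs_norm_sub_norm_le _ _).trans (norm_le_pi_norm (z - w) i)
    rw [Finset.card_univ, Fintype.card_fin] at h
    refine h.trans ?_
    rw [← mul_assoc]
    gcongr
    simp

/-- There exists `C > 0` (independent of `R`) such that
`‖Dψ_R(z)‖ ≤ C·R⁻²` for every `R > 2` and every `z ∈ ℂⁿ`. -/
theorem stmt14 (n : ℕ) (hn : 2 ≤ n) (eta : ℝ → ℝ) (heta : ContDiff ℝ 2 eta)
    (heta1 : ∀ r : ℝ, r ≤ 1 / 2 → eta r = 1) (heta0 : ∀ r : ℝ, 1 ≤ r → eta r = 0)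
    (l1 l2 : ℝ) (hl1 : 0 < l1) (hl2 : 0 < l2) :
    ∃ C : ℝ, 0 < C ∧ ∀ R : ℝ, 2 < R → ∀ z : Fin n → ℂ,
      ‖fderiv ℝ (psiR n l1 l2 eta R) z‖ ≤ C * R⁻¹ ^ 2 := by
  have heta' : ContDiff ℝ 1 eta := heta.of_le one_le_two
  obtain ⟨A, hA0, hA⟩ := exists_bound_and_lipschitz_PhiR n l1 l2 heta' heta0
  obtain ⟨B, hB0, hB⟩ := exists_bound_and_lipschitz_etaRfun n heta' heta0
  refine ⟨2 * (A * B) + 1, by positivity, fun R hR z => ?_⟩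
  have hR0 : 0 < R := by linarith
  obtain ⟨hPb, hPl⟩ := hA R hR0
  obtain ⟨hEb, hEl⟩ := hB R hR0
  have hC : 0 ≤ (2 * (A * B) + 1) * R⁻¹ ^ 2 := by positivity
  refine norm_fderiv_le_of_lipschitz ℝ (C := ⟨_, hC⟩) (LipschitzWith.of_dist_le_mul fun z w => ?_)
  rw [Real.dist_eq, dist_eq_norm]
  change _ ≤ (2 * (A * B) + 1) * R⁻¹ ^ 2 * ‖z - w‖
  have hRinv : R⁻¹ ≤ 1 := inv_le_one_of_one_le₀ (by linarith)
  calc |psiR n l1 l2 eta R z - psiR n l1 l2 eta R w|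
      = |PhiR n l1 l2 eta R z * (etaRfun n eta R z - etaRfun n eta R w)
          + (PhiR n l1 l2 eta R z - PhiR n l1 l2 eta R w) * etaRfun n eta R w| := by
        simp only [psiR]
        ring_nf
    _ ≤ |PhiR n l1 l2 eta R z| * |etaRfun n eta R z - etaRfun n eta R w|
          + |PhiR n l1 l2 eta R z - PhiR n l1 l2 eta R w| * |etaRfun n eta R w| := by
        rw [← abs_mul, ← abs_mul]
        exact abs_add_le _ _
    _ ≤ A * R⁻¹ ^ 4 * (B * R * ‖z - w‖) + A * R⁻¹ ^ 2 * ‖z - w‖ * B := by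
        gcongr
        exacts [hPb z, hEl z w, hPl z w, hEb w]
    _ = A * B * (R⁻¹ * R⁻¹ ^ 2) * ‖z - w‖ + A * B * R⁻¹ ^ 2 * ‖z - w‖ := by
        field_simp
    _ ≤ A * B * (1 * R⁻¹ ^ 2) * ‖z - w‖ + A * B * R⁻¹ ^ 2 * ‖z - w‖ := by gcongr
    _ ≤ (2 * (A * B) + 1) * R⁻¹ ^ 2 * ‖z - w‖ := by
        have : 0 ≤ R⁻¹ ^ 2 * ‖z - w‖ := by positivity
        linarith
end

section
/- There exists a constant C > 0, depending only on n, λ₁, λ₂ and η̃ (and independent of R), such that for every R > 2 and every z ∈ ℂⁿ, the second real Fréchet derivative of ψ_R satisfies ‖D²ψ_R(z)‖ ≤ C. (Part (2) of the paper's Lemma 3.3, in the flat model: all second-order coefficients |(ψ_R)_{α β̄}| are bounded uniformly in R.) -/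
/-- `f` is of class `C^N` and its derivatives up to order `N` are uniformly bounded. -/
def HasBoundedDerivs {E : Type*} [NormedAddCommGroup E] [NormedSpace ℝ E]
    (N : ℕ) (f : E → ℝ) : Prop :=
  ContDiff ℝ N f ∧ ∃ C : ℝ, ∀ k ≤ N, ∀ x, ‖iteratedFDeriv ℝ k f x‖ ≤ C

section HasBoundedDerivs

variable {E F : Type*} [NormedAddCommGroup E] [NormedSpace ℝ E]
  [NormedAddCommGroup F] [NormedSpace ℝ F] {N : ℕ}

theorem hasBoundedDerivs_of_forall_exists {f : E → ℝ} (hf : ContDiff ℝ N f)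
    (h : ∀ k ≤ N, ∃ C : ℝ, ∀ x, ‖iteratedFDeriv ℝ k f x‖ ≤ C) : HasBoundedDerivs N f := by
  choose! C hC using h
  refine ⟨hf, ∑ k ∈ Finset.range (N + 1), C k, fun k hk x => (hC k hk x).trans ?_⟩
  exact Finset.single_le_sum (f := C)
    (fun j hj => (norm_nonneg _).trans (hC j (Nat.lt_succ_iff.1 (Finset.mem_range.1 hj)) 0))
    (Finset.mem_range.2 (Nat.lt_succ_of_le hk))

theorem HasCompactSupport.hasBoundedDerivs {f : E → ℝ} (hs : HasCompactSupport f)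
    (hf : ContDiff ℝ N f) : HasBoundedDerivs N f :=
  hasBoundedDerivs_of_forall_exists hf fun k hk =>
    (hf.continuous_iteratedFDeriv (by exact_mod_cast hk)).bounded_above_of_compact_support
      (hs.iteratedFDeriv k)

theorem HasBoundedDerivs.comp_continuousLinearMap {f : F → ℝ} (hf : HasBoundedDerivs N f)
    (L : E →L[ℝ] F) : HasBoundedDerivs N fun x => f (L x) := by
  obtain ⟨hf, C, hC⟩ := hf
  refine hasBoundedDerivs_of_forall_exists (hf.comp L.contDiff) fun k hk =>
    ⟨C * ‖L‖ ^ k, fun x => ?_⟩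
  have h := L.iteratedFDeriv_comp_right hf x (i := k) (by exact_mod_cast hk)
  change ‖iteratedFDeriv ℝ k (f ∘ L) x‖ ≤ _
  rw [h]
  refine (ContinuousMultilinearMap.norm_compContinuousLinearMap_le _ _).trans ?_
  rw [Finset.prod_const, Finset.card_univ, Fintype.card_fin]
  gcongr
  exact hC k hk _

theorem HasBoundedDerivs.const_mul {f : E → ℝ} (hf : HasBoundedDerivs N f) (a : ℝ) :
    HasBoundedDerivs N fun x => a * f x := by
  obtain ⟨hf, C, hC⟩ := hf
  refine ⟨contDiff_const.mul hf, |a| * C, fun k hk x => ?_⟩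
  have h := iteratedFDeriv_const_smul_apply' (a := a) (x := x) (i := k)
    (hf.of_le (by exact_mod_cast hk)).contDiffAt
  simp only [smul_eq_mul] at h
  rw [h, norm_smul, Real.norm_eq_abs]
  gcongr
  exact hC k hk x

theorem HasBoundedDerivs.sum {ι : Type*} {s : Finset ι} {f : ι → E → ℝ}
    (hf : ∀ i ∈ s, HasBoundedDerivs N (f i)) : HasBoundedDerivs N fun x => ∑ i ∈ s, f i x := by
  choose! hc C hC using hf
  refine ⟨ContDiff.sum hc, ∑ i ∈ s, C i, fun k hk x => ?_⟩
  rw [iteratedFDeriv_sum fun i hi => (hc i hi).of_le (by exact_mod_cast hk), Finset.sum_apply]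
  exact norm_sum_le_of_le _ fun i hi => hC i hi k hk x

/-- The derivatives of a product of two rescaled functions: the factor `a⁻²` compensates the
second derivative of `x ↦ f (a • x)`. -/
theorem exists_norm_iteratedFDeriv_two_rescaled_mul_le {f g : E → ℝ}
    (hf : HasBoundedDerivs 2 f) (hg : HasBoundedDerivs 2 g) :
    ∃ C : ℝ, 0 < C ∧ ∀ a b : ℝ, 1 ≤ a → 1 ≤ b → b ≤ a → ∀ x,
      ‖iteratedFDeriv ℝ 2 (fun y => (a ^ 2)⁻¹ * f (a • y) * g (b • y)) x‖ ≤ C := by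
  obtain ⟨hf, A, hA⟩ := hf
  obtain ⟨hg, B, hB⟩ := hg
  have hA0 : 0 ≤ A := (norm_nonneg _).trans (hA 0 (by norm_num) 0)
  have hB0 : 0 ≤ B := (norm_nonneg _).trans (hB 0 (by norm_num) 0)
  refine ⟨4 * (A * B) + 1, by positivity, fun a b ha hb hba x => ?_⟩
  have hfa : ContDiff ℝ 2 fun y => f (a • y) := hf.comp (contDiff_const_smul a)
  have hgb : ContDiff ℝ 2 fun y => g (b • y) := hg.comp (contDiff_const_smul b)
  have hF : ∀ k ≤ 2, ‖iteratedFDeriv ℝ k (fun y => (a ^ 2)⁻¹ * f (a • y)) x‖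
      ≤ (a ^ 2)⁻¹ * (a ^ k * A) := fun k hk => by
    have hk' : (k : WithTop ℕ∞) ≤ (2 : ℕ) := by exact_mod_cast hk
    have h := iteratedFDeriv_const_smul_apply' (a := (a ^ 2)⁻¹) (x := x) (i := k)
      (hfa.of_le hk').contDiffAt
    simp only [smul_eq_mul] at h
    rw [h, iteratedFDeriv_comp_const_smul a (hf.of_le hk'), norm_smul, norm_smul,
      Real.norm_of_nonneg (by positivity), Real.norm_of_nonneg (by positivity)]
    gcongr
    exact hA k hk _
  have hG : ∀ k ≤ 2, ‖iteratedFDeriv ℝ k (fun y => g (b • y)) x‖ ≤ a ^ k * B := fun k hk => by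
    have hk' : (k : WithTop ℕ∞) ≤ (2 : ℕ) := by exact_mod_cast hk
    rw [iteratedFDeriv_comp_const_smul b (hg.of_le hk'), norm_smul,
      Real.norm_of_nonneg (by positivity)]
    gcongr
    exact hB k hk _
  calc _ ≤ _ := norm_iteratedFDeriv_mul_le (contDiff_const.mul hfa) hgb x (n := 2) le_rfl
    _ ≤ ∑ i ∈ Finset.range 3, ((2).choose i : ℝ) * (A * B) := by
      refine Finset.sum_le_sum fun i hi => ?_
      have hi : i ≤ 2 := Nat.lt_succ_iff.1 (Finset.mem_range.1 hi)
      have ha2 : a ^ i * a ^ (2 - i) = a ^ 2 := by rw [← pow_add, Nat.add_sub_cancel' hi]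
      rw [mul_assoc]
      refine mul_le_mul_of_nonneg_left ?_ (Nat.cast_nonneg _)
      calc _ ≤ (a ^ 2)⁻¹ * (a ^ i * A) * (a ^ (2 - i) * B) :=
            mul_le_mul (hF i hi) (hG _ (Nat.sub_le _ _)) (norm_nonneg _) (by positivity)
        _ = (a ^ 2)⁻¹ * (a ^ i * a ^ (2 - i)) * (A * B) := by ring
        _ = A * B := by rw [ha2, inv_mul_cancel₀ (by positivity), one_mul]
    _ ≤ 4 * (A * B) + 1 := by
      norm_num [Finset.sum_range_succ, Nat.choose]
      linarith

end HasBoundedDerivs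

/-- A `C^n` profile that is constant near `0` and below yields a `C^n` radial function. -/
theorem contDiff_comp_norm_of_eq_one {V : Type*} [NormedAddCommGroup V] [InnerProductSpace ℝ V]
    {n : WithTop ℕ∞} {eta : ℝ → ℝ} (heta : ContDiff ℝ n eta)
    (heta1 : ∀ r : ℝ, r ≤ 1 / 2 → eta r = 1) : ContDiff ℝ n fun w : V => eta ‖w‖ := by
  refine contDiff_iff_contDiffAt.2 fun w => ?_
  rcases eq_or_ne w 0 with rfl | hw
  · refine (contDiffAt_const (c := (1 : ℝ))).congr_of_eventuallyEq ?_
    filter_upwards [Metric.ball_mem_nhds (0 : V) (by norm_num : (0 : ℝ) < 1 / 2)] with w hw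
    exact heta1 _ (mem_ball_zero_iff.1 hw).le
  · exact heta.contDiffAt.comp w (contDiffAt_norm ℝ hw)

theorem hasCompactSupport_of_eq_zero_of_one_lt_norm {V : Type*} [NormedAddCommGroup V]
    [ProperSpace V] {f : V → ℝ} (hf : ∀ w, 1 < ‖w‖ → f w = 0) : HasCompactSupport f :=
  HasCompactSupport.intro (isCompact_closedBall (0 : V) 1) fun w hw =>
    hf w (by simpa using hw)

theorem psiR_eq_rescaled (n : ℕ) (l1 l2 : ℝ) (eta : ℝ → ℝ) {R : ℝ} (hR : 0 < R) :
    psiR n l1 l2 eta R = fun z =>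
      ((R ^ 2) ^ 2)⁻¹ * PhiR n l1 l2 eta 1 (R ^ 2 • z) * etaRfun n eta 1 (R • z) := by
  funext z
  simp only [psiR, PhiR, etaRfun, Pi.smul_apply, norm_smul, norm_pow, Real.norm_of_nonneg hR.le,
    one_pow, one_mul, Finset.mul_sum]
  congr 1
  refine Finset.sum_congr rfl fun i _ => ?_
  field_simp

/-- There exists `C > 0` (independent of `R`) such that
`‖D²ψ_R(z)‖ ≤ C` for every `R > 2` and every `z ∈ ℂⁿ`. -/
theorem stmt15 (n : ℕ) (hn : 2 ≤ n) (eta : ℝ → ℝ) (heta : ContDiff ℝ 2 eta)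
    (heta1 : ∀ r : ℝ, r ≤ 1 / 2 → eta r = 1) (heta0 : ∀ r : ℝ, 1 ≤ r → eta r = 0)
    (l1 l2 : ℝ) (hl1 : 0 < l1) (hl2 : 0 < l2) :
    ∃ C : ℝ, 0 < C ∧ ∀ R : ℝ, 2 < R → ∀ z : Fin n → ℂ,
      ‖iteratedFDeriv ℝ 2 (psiR n l1 l2 eta R) z‖ ≤ C := by
  have hη : ContDiff ℝ 2 fun w : ℂ => eta ‖w‖ := contDiff_comp_norm_of_eq_one heta heta1
  have hΦ : HasBoundedDerivs 2 (PhiR n l1 l2 eta 1) := by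
    have hg : HasBoundedDerivs 2 fun w : ℂ => ‖w‖ ^ 2 * eta ‖w‖ :=
      (hasCompactSupport_of_eq_zero_of_one_lt_norm fun w hw => by
        rw [heta0 _ hw.le, mul_zero]).hasBoundedDerivs ((contDiff_norm_sq ℝ).mul hη)
    have h := HasBoundedDerivs.sum (s := Finset.univ) fun (i : Fin n) _ =>
      (hg.comp_continuousLinearMap
        (ContinuousLinearMap.proj (R := ℝ) (φ := fun _ : Fin n => ℂ) i)).const_mul
        (if (i : ℕ) = 0 then l1 / 2 else if (i : ℕ) = 1 then l2 / 2 else 0)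
    convert h using 2 with z
    simp only [PhiR, one_pow, one_mul, mul_assoc, ContinuousLinearMap.proj_apply]
  have hG : HasBoundedDerivs 2 (etaRfun n eta 1) := by
    refine (hasCompactSupport_of_eq_zero_of_one_lt_norm fun z hz => ?_).hasBoundedDerivs ?_
    · obtain ⟨i, hi⟩ : ∃ i, 1 < ‖z i‖ := by
        by_contra! h
        exact hz.not_ge ((pi_norm_le_iff_of_nonneg zero_le_one).2 h)
      exact Finset.prod_eq_zero (Finset.mem_univ i) (heta0 _ (by simpa using hi.le))
    · have h : etaRfun n eta 1 = fun z => ∏ i, eta ‖z i‖ := by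
        funext z
        simp only [etaRfun, one_mul]
      rw [h]
      exact contDiff_prod fun i _ => hη.comp (contDiff_apply ℝ ℂ i)
  obtain ⟨C, hC0, hC⟩ := exists_norm_iteratedFDeriv_two_rescaled_mul_le hΦ hG
  refine ⟨C, hC0, fun R hR z => ?_⟩
  rw [psiR_eq_rescaled n l1 l2 eta (by linarith)]
  exact hC (R ^ 2) R (by nlinarith) (by linarith) (by nlinarith) z
end

section
/- There exists a constant C > 0, depending only on n, λ₁, λ₂ and η̃ (and independent of R), such that for every R > 2, every z ∈ ℂⁿ, and all vectors v, w ∈ ℂⁿ with v supported in the single coordinate α and w supported in the single coordinate β (i.e. v_j = 0 for j ≠ α and w_j = 0 for j ≠ β), where either α ≠ β, or α = β with α ≥ 3, one has |D²ψ_R(z)(v, w)| ≤ (C/R)·‖v‖·‖w‖. (This is the flat-frame case, where the continuous function σ of the paper vanishes identically, of the off-diagonal estimate |(ψ_R)_{α β̄}| ≤ C(σ + 1/R) in Lemma 3.3; it uses that Φ_R(z) depends only on z₁ and z₂ and splits as a sum of a function of z₁ and a function of z₂.) -/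
open Finset

/-- A `C²` function of the norm that is constant near the origin is `C²` on `ℂ`. -/
theorem contDiff_comp_norm {eta : ℝ → ℝ} (heta : ContDiff ℝ 2 eta)
    (heta1 : ∀ r : ℝ, r ≤ 1 / 2 → eta r = 1) : ContDiff ℝ 2 fun x : ℂ => eta ‖x‖ := by
  rw [contDiff_iff_contDiffAt]
  intro x
  by_cases hx : x = 0
  · subst hx
    refine (contDiffAt_const (c := (1 : ℝ))).congr_of_eventuallyEq ?_
    filter_upwards [Metric.ball_mem_nhds (0 : ℂ) (by norm_num : (0 : ℝ) < 1 / 2)] with y hy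
    exact heta1 _ (mem_ball_zero_iff.mp hy).le
  · exact heta.contDiffAt.comp x (contDiffAt_norm ℝ hx)

/-- The `R`-independent profile `c‖yᵢ‖² · ∏ⱼ η̃(‖yⱼ‖)` of the `i`-th summand of `ψ_R`. -/
noncomputable def profile {n : ℕ} (eta : ℝ → ℝ) (c : ℝ) (i : Fin n) (y : Fin n → ℂ) : ℝ :=
  c * ‖y i‖ ^ 2 * ∏ j, eta ‖y j‖

theorem contDiff_profile {n : ℕ} {eta : ℝ → ℝ} (heta : ContDiff ℝ 2 eta)
    (heta1 : ∀ r : ℝ, r ≤ 1 / 2 → eta r = 1) (c : ℝ) (i : Fin n) :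
    ContDiff ℝ 2 (profile eta c i) := by
  have h (j : Fin n) : ContDiff ℝ 2 fun y : Fin n → ℂ => y j := contDiff_apply ℝ ℂ j
  exact (contDiff_const.mul ((h i).norm_sq ℝ)).mul
    (contDiff_prod fun j _ => (contDiff_comp_norm heta heta1).comp (h j))

theorem hasCompactSupport_profile {n : ℕ} {eta : ℝ → ℝ}
    (heta0 : ∀ r : ℝ, 1 ≤ r → eta r = 0) (c : ℝ) (i : Fin n) :
    HasCompactSupport (profile eta c i) := by
  refine HasCompactSupport.intro (isCompact_closedBall (0 : Fin n → ℂ) 1) fun y hy => ?_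
  rw [mem_closedBall_zero_iff, pi_norm_le_iff_of_nonneg zero_le_one] at hy
  push Not at hy
  obtain ⟨j, hj⟩ := hy
  rw [profile, prod_eq_zero (mem_univ j) (heta0 _ hj.le), mul_zero]

theorem exists_bound_iteratedFDeriv_profile {n : ℕ} {eta : ℝ → ℝ} (heta : ContDiff ℝ 2 eta)
    (heta1 : ∀ r : ℝ, r ≤ 1 / 2 → eta r = 1) (heta0 : ∀ r : ℝ, 1 ≤ r → eta r = 0)
    (c : ℝ) (i : Fin n) :
    ∃ C : ℝ, ∀ y, ‖iteratedFDeriv ℝ 2 (profile eta c i) y‖ ≤ C :=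
  ((hasCompactSupport_profile heta0 c i).iteratedFDeriv 2).exists_bound_of_continuous
    ((contDiff_profile heta heta1 c i).continuous_iteratedFDeriv le_rfl)

/-- The scaling factor of the `j`-th coordinate in the `i`-th summand of `ψ_R`. -/
def scaleFactor {n : ℕ} (R : ℝ) (i j : Fin n) : ℝ := if j = i then R ^ 2 else R

/-- The anisotropic dilation of `ℂⁿ` with factors `scaleFactor R i`. -/
noncomputable def dilation {n : ℕ} (R : ℝ) (i : Fin n) : (Fin n → ℂ) →L[ℝ] (Fin n → ℂ) :=
  ContinuousLinearMap.pi fun j => scaleFactor R i j • ContinuousLinearMap.proj j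

theorem dilation_apply {n : ℕ} (R : ℝ) (i j : Fin n) (z : Fin n → ℂ) :
    dilation R i z j = scaleFactor R i j • z j := rfl

theorem dilation_of_support {n : ℕ} (R : ℝ) (i α : Fin n) {v : Fin n → ℂ}
    (hv : ∀ j, j ≠ α → v j = 0) : dilation R i v = scaleFactor R i α • v := by
  ext1 j
  rw [dilation_apply, Pi.smul_apply]
  rcases eq_or_ne j α with rfl | h
  · rfl
  · rw [hv j h, smul_zero, smul_zero]

theorem scaleFactor_pos {n : ℕ} {R : ℝ} (hR : 0 < R) (i j : Fin n) : 0 < scaleFactor R i j := by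
  unfold scaleFactor
  split_ifs <;> positivity

theorem scaleFactor_mul_le {n : ℕ} {R : ℝ} (hR : 1 ≤ R) {i α β : Fin n}
    (h : ¬(α = i ∧ β = i)) : scaleFactor R i α * scaleFactor R i β ≤ R ^ 3 := by
  have h2 : R * R ≤ R ^ 3 := by
    rw [← sq]
    exact pow_le_pow_right₀ hR (by norm_num)
  unfold scaleFactor
  split_ifs with ha hb hb
  · exact absurd ⟨ha, hb⟩ h
  · exact (by ring : R ^ 2 * R = R ^ 3).le
  · exact (by ring : R * R ^ 2 = R ^ 3).le
  · exact h2

/-- Where the inner cutoff does not vanish, the factor `η̃(R|zᵢ|)` of the outer one is `1`. -/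
theorem eta_sq_mul_prod_eq {n : ℕ} {eta : ℝ → ℝ} (heta1 : ∀ r : ℝ, r ≤ 1 / 2 → eta r = 1)
    (heta0 : ∀ r : ℝ, 1 ≤ r → eta r = 0) {R : ℝ} (hR : 2 < R) (i : Fin n) (z : Fin n → ℂ) :
    eta (R ^ 2 * ‖z i‖) * ∏ j, eta (R * ‖z j‖) = ∏ j, eta ‖dilation R i z j‖ := by
  have hR0 : 0 < R := by linarith
  have hnorm (j : Fin n) : ‖dilation R i z j‖ = scaleFactor R i j * ‖z j‖ := by
    rw [dilation_apply, norm_smul, Real.norm_of_nonneg (scaleFactor_pos hR0 i j).le]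
  have hrest : ∏ j ∈ univ.erase i, eta ‖dilation R i z j‖
      = ∏ j ∈ univ.erase i, eta (R * ‖z j‖) :=
    prod_congr rfl fun j hj => by rw [hnorm, scaleFactor, if_neg (ne_of_mem_erase hj)]
  rw [← mul_prod_erase univ _ (mem_univ i),
    ← mul_prod_erase univ (fun j => eta ‖dilation R i z j‖) (mem_univ i), hrest, hnorm,
    scaleFactor, if_pos rfl]
  rcases le_or_gt 1 (R ^ 2 * ‖z i‖) with h | h
  · rw [heta0 _ h, zero_mul, zero_mul]
  · rw [heta1 (R * ‖z i‖) (by nlinarith [norm_nonneg (z i)]), one_mul]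

theorem psiR_eq_sum_profile {n : ℕ} {eta : ℝ → ℝ} (heta1 : ∀ r : ℝ, r ≤ 1 / 2 → eta r = 1)
    (heta0 : ∀ r : ℝ, 1 ≤ r → eta r = 0) (l1 l2 : ℝ) {R : ℝ} (hR : 2 < R) :
    psiR n l1 l2 eta R = fun z => ∑ i : Fin n, (R ^ 4)⁻¹ •
      (profile eta (if (i : ℕ) = 0 then l1 / 2 else if (i : ℕ) = 1 then l2 / 2 else 0) i ∘
        dilation R i) z := by
  have hR0 : 0 < R := by linarith
  funext z
  rw [psiR, PhiR, etaRfun, sum_mul]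
  refine sum_congr rfl fun i _ => ?_
  rw [mul_assoc, eta_sq_mul_prod_eq heta1 heta0 hR, Function.comp_apply, profile, dilation_apply,
    norm_smul, scaleFactor, if_pos rfl, Real.norm_of_nonneg (by positivity), smul_eq_mul]
  field_simp

theorem iteratedFDeriv_psiR_apply {n : ℕ} {eta : ℝ → ℝ} (heta : ContDiff ℝ 2 eta)
    (heta1 : ∀ r : ℝ, r ≤ 1 / 2 → eta r = 1) (heta0 : ∀ r : ℝ, 1 ≤ r → eta r = 0)
    (l1 l2 : ℝ) {R : ℝ} (hR : 2 < R) (z v w : Fin n → ℂ) :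
    iteratedFDeriv ℝ 2 (psiR n l1 l2 eta R) z ![v, w] = ∑ i : Fin n, (R ^ 4)⁻¹ *
      iteratedFDeriv ℝ 2
        (profile eta (if (i : ℕ) = 0 then l1 / 2 else if (i : ℕ) = 1 then l2 / 2 else 0) i)
        (dilation R i z) ![dilation R i v, dilation R i w] := by
  have hQ (c : ℝ) (i : Fin n) := contDiff_profile heta heta1 c i
  rw [psiR_eq_sum_profile heta1 heta0 l1 l2 hR, iteratedFDeriv_fun_sum_apply
    fun i _ => (((hQ _ i).comp (dilation R i).contDiff).const_smul _).contDiffAt,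
    _root_.sum_apply]
  refine sum_congr rfl fun i _ => ?_
  rw [iteratedFDeriv_const_smul_apply' ((hQ _ i).comp (dilation R i).contDiff).contDiffAt,
    (dilation R i).iteratedFDeriv_comp_right (hQ _ i) z le_rfl,
    _root_.smul_apply, smul_eq_mul,
    ContinuousMultilinearMap.compContinuousLinearMap_apply]
  congr 2
  funext k
  fin_cases k <;> rfl

/-- Off-diagonal estimate, flat frame.  There exists `C > 0`
(independent of `R`) such that for every `R > 2`, every `z ∈ ℂⁿ`, and all
vectors `v, w` supported respectively in single coordinates `α, β` with either
`α ≠ β`, or `α = β` of 1-based index `≥ 3` (i.e. `2 ≤ (α : ℕ)` 0-based), one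
has `|D²ψ_R(z)(v, w)| ≤ (C/R)·‖v‖·‖w‖`. -/
theorem stmt16 (n : ℕ) (hn : 2 ≤ n) (eta : ℝ → ℝ) (heta : ContDiff ℝ 2 eta)
    (heta1 : ∀ r : ℝ, r ≤ 1 / 2 → eta r = 1) (heta0 : ∀ r : ℝ, 1 ≤ r → eta r = 0)
    (l1 l2 : ℝ) (hl1 : 0 < l1) (hl2 : 0 < l2) :
    ∃ C : ℝ, 0 < C ∧ ∀ R : ℝ, 2 < R → ∀ z : Fin n → ℂ,
      ∀ α β : Fin n, ∀ v w : Fin n → ℂ,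
        (∀ j : Fin n, j ≠ α → v j = 0) → (∀ j : Fin n, j ≠ β → w j = 0) →
        (α ≠ β ∨ (α = β ∧ 2 ≤ (α : ℕ))) →
        |iteratedFDeriv ℝ 2 (psiR n l1 l2 eta R) z ![v, w]|
          ≤ C / R * ‖v‖ * ‖w‖ := by
  choose C hC using fun i : Fin n => exists_bound_iteratedFDeriv_profile heta heta1 heta0
    (if (i : ℕ) = 0 then l1 / 2 else if (i : ℕ) = 1 then l2 / 2 else 0) i
  have hC0 (i : Fin n) : 0 ≤ C i := (norm_nonneg _).trans (hC i 0)
  refine ⟨∑ i, C i + 1, add_pos_of_nonneg_of_pos (sum_nonneg fun i _ => hC0 i) one_pos, ?_⟩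
  intro R hR z α β v w hv hw hαβ
  have hR0 : 0 < R := by linarith
  rw [iteratedFDeriv_psiR_apply heta heta1 heta0 l1 l2 hR]
  have hterm (i : Fin n) : |(R ^ 4)⁻¹ * iteratedFDeriv ℝ 2
      (profile eta (if (i : ℕ) = 0 then l1 / 2 else if (i : ℕ) = 1 then l2 / 2 else 0) i)
      (dilation R i z) ![dilation R i v, dilation R i w]| ≤ C i / R * ‖v‖ * ‖w‖ := by
    have hnonneg : 0 ≤ C i / R * ‖v‖ * ‖w‖ := by have := hC0 i; positivity
    by_cases hi : 2 ≤ (i : ℕ)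
    · have hzero : profile eta
          (if (i : ℕ) = 0 then l1 / 2 else if (i : ℕ) = 1 then l2 / 2 else 0) i = 0 := by
        funext y
        rw [profile, if_neg (by omega), if_neg (by omega), zero_mul, zero_mul, Pi.zero_apply]
      simpa [hzero] using hnonneg
    have hs : scaleFactor R i α * scaleFactor R i β ≤ R ^ 3 := by
      refine scaleFactor_mul_le (by linarith) ?_
      rintro ⟨rfl, rfl⟩
      rcases hαβ with h | h
      · exact h rfl
      · exact hi h.2
    have hD := (iteratedFDeriv ℝ 2
      (profile eta (if (i : ℕ) = 0 then l1 / 2 else if (i : ℕ) = 1 then l2 / 2 else 0) i)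
      (dilation R i z)).le_of_opNorm_le (hC i _) ![dilation R i v, dilation R i w]
    rw [dilation_of_support R i α hv, dilation_of_support R i β hw] at hD ⊢
    rw [Fin.prod_univ_two, Matrix.cons_val_zero, Matrix.cons_val_one, Matrix.cons_val_zero,
      norm_smul, norm_smul,
      Real.norm_of_nonneg (scaleFactor_pos hR0 i α).le,
      Real.norm_of_nonneg (scaleFactor_pos hR0 i β).le] at hD
    rw [abs_mul, abs_of_pos (by positivity : 0 < (R ^ 4)⁻¹)]
    calc _ ≤ (R ^ 4)⁻¹ * (C i * (scaleFactor R i α * ‖v‖ * (scaleFactor R i β * ‖w‖))) := by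
          gcongr
          exact hD
      _ = (R ^ 4)⁻¹ * (C i * (scaleFactor R i α * scaleFactor R i β) * (‖v‖ * ‖w‖)) := by ring
      _ ≤ (R ^ 4)⁻¹ * (C i * R ^ 3 * (‖v‖ * ‖w‖)) := by
          have := hC0 i
          gcongr
      _ = C i / R * ‖v‖ * ‖w‖ := by field_simp
  calc _ ≤ ∑ i, C i / R * ‖v‖ * ‖w‖ := (abs_sum_le_sum_abs _ _).trans (sum_le_sum fun i _ => hterm i)
    _ = (∑ i, C i) / R * ‖v‖ * ‖w‖ := by simp only [← sum_mul, ← sum_div]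
    _ ≤ (∑ i, C i + 1) / R * ‖v‖ * ‖w‖ := by gcongr; linarith
end
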